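/- arXiv:math/0306036 — 2 statements merged into one kernel-verified Lean document; each statement's English description precedes it below -/
import Mathlib

section
/- The polynomial part P_A(t) of the restricted partition function equals the negative of the residue at z = 0 of e^{-tz} / ((1 - e^{a_1 z}) ⋯ (1 - e^{a_n z})); equivalently, P_A(t) is the constant term in z of -z e^{-tz} / ((1 - e^{a_1 z}) ⋯ (1 - e^{a_n z})). -/
open PowerSeries

/-- The restricted partition function. -/
noncomputable def restrictedPartition (n : ℕ) (a : Fin n → ℕ) (t : ℕ) : ℕ :=
  Nat.card {m : Fin n → ℕ // ∑ i, m i * a i = t}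

open LaurentSeries

/-- Prefer the coefficientwise algebra structure over `HahnSeries.powerSeriesAlgebra`, which is not
definitionally equal to it. -/
noncomputable local instance : Algebra ℂ (LaurentSeries ℂ) := HahnSeries.instAlgebra

/-- The Euler operator `z d/dz` on formal Laurent series, as a function. -/
def eulerFun (f : LaurentSeries ℂ) : LaurentSeries ℂ where
  coeff k := (k : ℂ) * f.coeff k
  isPWO_support' := f.isPWO_support.mono fun _ hk => right_ne_zero_of_mul hk

theorem coeff_eulerFun (f : LaurentSeries ℂ) (k : ℤ) :
    (eulerFun f).coeff k = (k : ℂ) * f.coeff k := rfl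

theorem support_eulerFun_subset (f : LaurentSeries ℂ) : (eulerFun f).support ⊆ f.support :=
  fun _ hk => right_ne_zero_of_mul hk

theorem eulerFun_mul (f g : LaurentSeries ℂ) :
    eulerFun (f * g) = f * eulerFun g + eulerFun f * g := by
  ext k
  rw [HahnSeries.coeff_add, coeff_eulerFun, HahnSeries.coeff_mul,
    HahnSeries.coeff_mul_right' g.isPWO_support (support_eulerFun_subset g),
    HahnSeries.coeff_mul_left' f.isPWO_support (support_eulerFun_subset f), Finset.mul_sum,
    ← Finset.sum_add_distrib]
  refine Finset.sum_congr rfl fun ij hij => ?_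
  rw [coeff_eulerFun, coeff_eulerFun, ← (Finset.mem_antidiagonal.1 hij).2.2]
  push_cast
  ring

/-- The Euler operator `z d/dz` on formal Laurent series, as a derivation. -/
noncomputable def eulerDerivation : Derivation ℂ (LaurentSeries ℂ) (LaurentSeries ℂ) :=
  Derivation.mk'
    { toFun := eulerFun
      map_add' := fun f g => by ext k; simp [coeff_eulerFun, mul_add]
      map_smul' := fun c f => by ext k; simp [coeff_eulerFun, mul_left_comm] }
    fun f g => (eulerFun_mul f g).trans (by simp [mul_comm])

theorem coeff_eulerDerivation (f : LaurentSeries ℂ) (k : ℤ) :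
    (eulerDerivation f).coeff k = (k : ℂ) * f.coeff k := rfl

/-- The Laurent series of `e^{cz}`. -/
noncomputable def laurentExp (c : ℂ) : LaurentSeries ℂ :=
  ((PowerSeries.rescale c (PowerSeries.exp ℂ) : PowerSeries ℂ) : LaurentSeries ℂ)

/-- The Laurent series variable `z`. -/
noncomputable def laurentX : LaurentSeries ℂ := ((PowerSeries.X : PowerSeries ℂ) : LaurentSeries ℂ)

theorem laurentX_ne_zero : laurentX ≠ 0 := by
  simp [laurentX]

theorem coeff_coe_powerSeries_of_neg (p : PowerSeries ℂ) {k : ℤ} (hk : k < 0) :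
    (p : LaurentSeries ℂ).coeff k = 0 := by
  rw [PowerSeries.coeff_coe, if_pos hk]

theorem eulerDerivation_coe (p : PowerSeries ℂ) :
    eulerDerivation (p : LaurentSeries ℂ) =
      ((PowerSeries.X * PowerSeries.derivative ℂ p : PowerSeries ℂ) : LaurentSeries ℂ) := by
  ext k
  rw [coeff_eulerDerivation]
  rcases lt_or_ge k 0 with hk | hk
  · simp only [coeff_coe_powerSeries_of_neg _ hk, mul_zero]
  · lift k to ℕ using hk
    rw [coeff_coe_powerSeries, coeff_coe_powerSeries]
    cases k with
    | zero => simp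
    | succ k =>
      rw [PowerSeries.coeff_succ_X_mul, PowerSeries.coeff_derivative]
      push_cast
      ring

theorem derivative_rescale_exp (c : ℂ) :
    PowerSeries.derivative ℂ (PowerSeries.rescale c (PowerSeries.exp ℂ)) =
      PowerSeries.C c * PowerSeries.rescale c (PowerSeries.exp ℂ) := by
  ext k
  simp only [PowerSeries.coeff_derivative, PowerSeries.coeff_rescale, PowerSeries.coeff_C_mul,
    PowerSeries.coeff_exp, Nat.factorial_succ, pow_succ, map_div₀, map_one, map_natCast]
  have h1 : ((k : ℂ) + 1) ≠ 0 := by exact_mod_cast k.succ_ne_zero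
  have h2 : (k.factorial : ℂ) ≠ 0 := by exact_mod_cast k.factorial_ne_zero
  push_cast
  field_simp

theorem eulerDerivation_laurentExp (c : ℂ) :
    eulerDerivation (laurentExp c) = HahnSeries.C c * (laurentX * laurentExp c) := by
  rw [laurentExp, eulerDerivation_coe, derivative_rescale_exp, mul_left_comm,
    PowerSeries.coe_mul, PowerSeries.coe_mul, PowerSeries.coe_C, laurentX]

theorem coe_aeval_exp (p : Polynomial ℂ) :
    ((Polynomial.aeval (PowerSeries.exp ℂ) p : PowerSeries ℂ) : LaurentSeries ℂ) =
      Polynomial.aeval (laurentExp 1) p := by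
  have h1 : laurentExp 1 = ((PowerSeries.exp ℂ : PowerSeries ℂ) : LaurentSeries ℂ) := by
    simp [laurentExp]
  rw [h1, Polynomial.aeval_def, Polynomial.aeval_def, Polynomial.hom_eval₂]
  congr 1
  ext c : 1
  rw [← HahnSeries.C_eq_algebraMap]
  simp [PowerSeries.algebraMap_eq]

theorem constantCoeff_aeval_exp (p : Polynomial ℂ) :
    PowerSeries.constantCoeff (Polynomial.aeval (PowerSeries.exp ℂ) p) = p.eval 1 := by
  rw [Polynomial.aeval_def, Polynomial.hom_eval₂, PowerSeries.constantCoeff_exp, Polynomial.eval]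
  rfl

theorem exp_sub_one_ne_zero : PowerSeries.exp ℂ - 1 ≠ 0 := fun h => by
  have := congrArg (PowerSeries.coeff 1) h
  simp [PowerSeries.coeff_exp, PowerSeries.coeff_one] at this

theorem aeval_exp_ne_zero {p : Polynomial ℂ} (hp : p ≠ 0) :
    Polynomial.aeval (PowerSeries.exp ℂ) p ≠ 0 := by
  obtain ⟨q, hq, hdvd⟩ := Polynomial.exists_eq_pow_rootMultiplicity_mul_and_not_dvd p hp 1
  rw [Polynomial.dvd_iff_isRoot, Polynomial.IsRoot.def, ← constantCoeff_aeval_exp] at hdvd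
  rw [hq, map_mul, map_pow]
  refine mul_ne_zero (pow_ne_zero _ ?_) fun h => hdvd (by rw [h, map_zero])
  simpa using exp_sub_one_ne_zero

theorem aeval_laurentExp_ne_zero {p : Polynomial ℂ} (hp : p ≠ 0) :
    Polynomial.aeval (laurentExp 1) p ≠ 0 := by
  rw [← coe_aeval_exp]
  exact (map_ne_zero_iff _ HahnSeries.ofPowerSeries_injective).2 (aeval_exp_ne_zero hp)

/-- `f` is the expansion of a rational function `N / D` at `x = 0`, and `g` is the expansion at
`z = 0` of the same rational function evaluated at `x = e^z`. -/
def IsExpSubst (f : PowerSeries ℂ) (g : LaurentSeries ℂ) : Prop :=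
  ∃ N D : Polynomial ℂ, D ≠ 0 ∧ f * (D : PowerSeries ℂ) = (N : PowerSeries ℂ) ∧
    g * Polynomial.aeval (laurentExp 1) D = Polynomial.aeval (laurentExp 1) N

namespace IsExpSubst

variable {f f₁ f₂ : PowerSeries ℂ} {g g₁ g₂ : LaurentSeries ℂ}

theorem unique (h₁ : IsExpSubst f g₁) (h₂ : IsExpSubst f g₂) : g₁ = g₂ := by
  obtain ⟨N₁, D₁, hD₁, hf₁, hg₁⟩ := h₁
  obtain ⟨N₂, D₂, hD₂, hf₂, hg₂⟩ := h₂
  have h : N₁ * D₂ = N₂ * D₁ := by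
    apply Polynomial.coe_injective ℂ
    rw [Polynomial.coe_mul, Polynomial.coe_mul, ← hf₁, ← hf₂]
    ring
  have h' := congrArg (Polynomial.aeval (laurentExp 1)) h
  rw [map_mul, map_mul, ← hg₁, ← hg₂] at h'
  refine mul_right_cancel₀ (mul_ne_zero (aeval_laurentExp_ne_zero hD₁)
    (aeval_laurentExp_ne_zero hD₂)) ?_
  linear_combination h'

theorem zero : IsExpSubst 0 0 := ⟨0, 1, one_ne_zero, by simp, by simp⟩

theorem add (h₁ : IsExpSubst f₁ g₁) (h₂ : IsExpSubst f₂ g₂) :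
    IsExpSubst (f₁ + f₂) (g₁ + g₂) := by
  obtain ⟨N₁, D₁, hD₁, hf₁, hg₁⟩ := h₁
  obtain ⟨N₂, D₂, hD₂, hf₂, hg₂⟩ := h₂
  refine ⟨N₁ * D₂ + N₂ * D₁, D₁ * D₂, mul_ne_zero hD₁ hD₂, ?_, ?_⟩
  · simp only [Polynomial.coe_add, Polynomial.coe_mul, ← hf₁, ← hf₂]
    ring
  · simp only [map_add, map_mul, ← hg₁, ← hg₂]
    ring

theorem sum {ι : Type*} (s : Finset ι) {f : ι → PowerSeries ℂ} {g : ι → LaurentSeries ℂ}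
    (h : ∀ i ∈ s, IsExpSubst (f i) (g i)) : IsExpSubst (∑ i ∈ s, f i) (∑ i ∈ s, g i) := by
  classical
  induction s using Finset.induction_on with
  | empty => simpa using zero
  | insert i s hi ih =>
    rw [Finset.sum_insert hi, Finset.sum_insert hi]
    exact (h i (Finset.mem_insert_self i s)).add
      (ih fun j hj => h j (Finset.mem_insert_of_mem hj))

theorem C_mul (c : ℂ) (h : IsExpSubst f g) :
    IsExpSubst (PowerSeries.C c * f) (HahnSeries.C c * g) := by
  obtain ⟨N, D, hD, hf, hg⟩ := h
  refine ⟨Polynomial.C c * N, D, hD, ?_, ?_⟩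
  · rw [mul_assoc, hf, Polynomial.coe_mul, Polynomial.coe_C]
  · rw [mul_assoc, hg, map_mul, Polynomial.aeval_C, HahnSeries.C_eq_algebraMap]

theorem X_mul_derivative (h : IsExpSubst f g) :
    IsExpSubst (PowerSeries.X * PowerSeries.derivative ℂ f) (laurentX⁻¹ * eulerDerivation g) := by
  obtain ⟨N, D, hD, hf, hg⟩ := h
  refine ⟨Polynomial.X * (Polynomial.derivative N * D - N * Polynomial.derivative D), D ^ 2,
    pow_ne_zero 2 hD, ?_, ?_⟩
  · have h := congrArg (PowerSeries.derivative ℂ) hf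
    rw [Derivation.leibniz, PowerSeries.derivative_coe, PowerSeries.derivative_coe,
      smul_eq_mul, smul_eq_mul] at h
    simp only [Polynomial.coe_mul, Polynomial.coe_sub, Polynomial.coe_pow, Polynomial.coe_X, ← h,
      ← hf]
    ring
  · have h := congrArg eulerDerivation hg
    rw [Derivation.leibniz, Derivation.map_aeval, Derivation.map_aeval, eulerDerivation_laurentExp,
      map_one, one_mul, smul_eq_mul, smul_eq_mul, smul_eq_mul, smul_eq_mul] at h
    simp only [map_mul, map_sub, map_pow, Polynomial.aeval_X]
    apply mul_left_cancel₀ laurentX_ne_zero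
    rw [← mul_assoc, mul_inv_cancel_left₀ laurentX_ne_zero, ← hg]
    linear_combination (Polynomial.aeval (laurentExp 1) D) * h

end IsExpSubst

/-- The residue at `z = 0` of `e^{-sz} g(z)`, as the constant term of `z e^{-sz} g(z)`. -/
noncomputable def twistedResidue (s : ℂ) : LaurentSeries ℂ →+ ℂ where
  toFun g := (laurentX * laurentExp (-s) * g).coeff 0
  map_zero' := by simp
  map_add' f g := by simp [mul_add]

theorem twistedResidue_apply (s : ℂ) (g : LaurentSeries ℂ) :
    twistedResidue s g = (laurentX * laurentExp (-s) * g).coeff 0 := rfl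

theorem twistedResidue_C_mul (s c : ℂ) (g : LaurentSeries ℂ) :
    twistedResidue s (HahnSeries.C c * g) = c * twistedResidue s g := by
  rw [twistedResidue_apply, mul_left_comm, HahnSeries.C_apply, HahnSeries.coeff_single_zero_mul,
    twistedResidue_apply]

theorem twistedResidue_eulerDerivation (s : ℂ) (g : LaurentSeries ℂ) :
    twistedResidue s (laurentX⁻¹ * eulerDerivation g) = s * twistedResidue s g := by
  have h := coeff_eulerDerivation (laurentExp (-s) * g) 0
  rw [Derivation.leibniz, eulerDerivation_laurentExp, smul_eq_mul, smul_eq_mul, mul_left_comm g,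
    HahnSeries.coeff_add, HahnSeries.C_apply, HahnSeries.coeff_single_zero_mul, Int.cast_zero,
    zero_mul, mul_comm g] at h
  rw [twistedResidue_apply, twistedResidue_apply, mul_comm laurentX (laurentExp _), mul_assoc,
    mul_inv_cancel_left₀ laurentX_ne_zero, mul_comm (laurentExp _) laurentX]
  linear_combination h

theorem twistedResidue_inv {p q : PowerSeries ℂ} (hp : p ≠ 0) (h : p * q = PowerSeries.X) (s : ℂ) :
    twistedResidue s (p : LaurentSeries ℂ)⁻¹ = PowerSeries.constantCoeff q := by
  have hp' : (p : LaurentSeries ℂ) ≠ 0 :=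
    (map_ne_zero_iff _ HahnSeries.ofPowerSeries_injective).2 hp
  have h' : laurentX * laurentExp (-s) * (p : LaurentSeries ℂ)⁻¹ =
      ((PowerSeries.rescale (-s) (PowerSeries.exp ℂ) * q : PowerSeries ℂ) : LaurentSeries ℂ) := by
    rw [← div_eq_mul_inv, div_eq_iff hp', laurentX, ← h, laurentExp, PowerSeries.coe_mul,
      PowerSeries.coe_mul]
    ring
  rw [twistedResidue_apply, h', ← Nat.cast_zero (R := ℤ), coeff_coe_powerSeries]
  rw [PowerSeries.coeff_zero_eq_constantCoeff_apply, map_mul,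
    ← PowerSeries.coeff_zero_eq_constantCoeff_apply, PowerSeries.coeff_rescale]
  simp

theorem mk_pow_mul_one_sub (μ : ℂ) :
    PowerSeries.mk (fun t => μ ^ t) * (1 - PowerSeries.C μ * PowerSeries.X) = 1 := by
  ext t
  cases t with
  | zero => simp
  | succ t =>
    rw [mul_sub, mul_one, mul_left_comm, map_sub, PowerSeries.coeff_C_mul,
      PowerSeries.coeff_succ_mul_X]
    simp [PowerSeries.coeff_one, pow_succ']

theorem one_sub_smul_exp_ne_zero (μ : ℂ) :
    (1 - PowerSeries.C μ * PowerSeries.exp ℂ : PowerSeries ℂ) ≠ 0 := fun h => by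
  have h0 := congrArg (PowerSeries.coeff 0) h
  have h1 := congrArg (PowerSeries.coeff 1) h
  simp [PowerSeries.coeff_exp, PowerSeries.coeff_one] at h0 h1
  simp [h1] at h0

theorem exists_isExpSubst_geometric (μ : ℂ) :
    ∃ g, IsExpSubst (PowerSeries.mk fun t => μ ^ t) g ∧
      ∀ s, twistedResidue s g = if μ = 1 then -1 else 0 := by
  have hne := one_sub_smul_exp_ne_zero μ
  have haeval : Polynomial.aeval (PowerSeries.exp ℂ) (1 - Polynomial.C μ * Polynomial.X) =
      1 - PowerSeries.C μ * PowerSeries.exp ℂ := by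
    simp [PowerSeries.algebraMap_eq]
  refine ⟨((1 - PowerSeries.C μ * PowerSeries.exp ℂ : PowerSeries ℂ) : LaurentSeries ℂ)⁻¹,
    ⟨1, 1 - Polynomial.C μ * Polynomial.X, fun h => ?_, ?_, ?_⟩, fun s => ?_⟩
  · simpa using congrArg (Polynomial.eval 0) h
  · simpa using mk_pow_mul_one_sub μ
  · rw [← coe_aeval_exp, haeval, map_one]
    exact inv_mul_cancel₀ ((map_ne_zero_iff _ HahnSeries.ofPowerSeries_injective).2 hne)
  · split_ifs with hμ
    · subst hμ
      obtain ⟨u, hu⟩ : (PowerSeries.X : PowerSeries ℂ) ∣ PowerSeries.exp ℂ - 1 := by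
        rw [PowerSeries.X_dvd_iff]
        simp
      have hu0 : PowerSeries.constantCoeff u = 1 := by
        have := congrArg (PowerSeries.coeff 1) hu
        rw [← zero_add 1, PowerSeries.coeff_succ_X_mul] at this
        simpa [PowerSeries.coeff_exp, PowerSeries.coeff_one] using this.symm
      rw [twistedResidue_inv (q := -u⁻¹) hne]
      · simp [hu0]
      · have : u * u⁻¹ = 1 := PowerSeries.mul_inv_cancel u (by simp [hu0])
        rw [map_one, one_mul]
        linear_combination PowerSeries.X * this + u⁻¹ * hu
    · rw [twistedResidue_inv (q := PowerSeries.X * (1 - PowerSeries.C μ * PowerSeries.exp ℂ)⁻¹) hne]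
      · simp
      · rw [mul_left_comm, PowerSeries.mul_inv_cancel, mul_one]
        simpa [sub_eq_zero] using Ne.symm hμ

theorem exists_isExpSubst_polynomial_mul_pow (μ : ℂ) (Q : Polynomial ℂ) :
    ∃ g, IsExpSubst (PowerSeries.mk fun t => Q.eval (t : ℂ) * μ ^ t) g ∧
      ∀ s, twistedResidue s g = if μ = 1 then -Q.eval s else 0 := by
  induction Q using Polynomial.induction_on with
  | C c =>
    obtain ⟨g, hg, hres⟩ := exists_isExpSubst_geometric μ
    refine ⟨HahnSeries.C c * g, ?_, fun s => ?_⟩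
    · convert hg.C_mul c using 1
      ext t
      simp
    · rw [twistedResidue_C_mul, hres]
      simp
  | add p q hp hq =>
    obtain ⟨g₁, hg₁, hres₁⟩ := hp
    obtain ⟨g₂, hg₂, hres₂⟩ := hq
    refine ⟨g₁ + g₂, ?_, fun s => ?_⟩
    · convert hg₁.add hg₂ using 1
      ext t
      simp [add_mul]
    · rw [map_add, hres₁, hres₂]
      split_ifs
      · rw [Polynomial.eval_add, neg_add]
      · rw [add_zero]
  | monomial k c ih =>
    obtain ⟨g, hg, hres⟩ := ih
    refine ⟨laurentX⁻¹ * eulerDerivation g, ?_, fun s => ?_⟩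
    · convert hg.X_mul_derivative using 1
      ext t
      cases t with
      | zero => simp
      | succ t =>
        rw [PowerSeries.coeff_succ_X_mul, PowerSeries.coeff_derivative]
        simp [pow_succ]
        ring
    · rw [twistedResidue_eulerDerivation, hres]
      split_ifs
      · simp [pow_succ]
        ring
      · rw [mul_zero]

theorem dvd_sub_self_iff {b t : ℕ} (h : b ≤ t) : b ∣ t - b ↔ b ∣ t :=
  Nat.dvd_sub_iff_left h dvd_rfl

theorem mk_dvd_mul_one_sub_X_pow {b : ℕ} (hb : 0 < b) :
    PowerSeries.mk (fun t => if b ∣ t then (1 : ℂ) else 0) * (1 - PowerSeries.X ^ b) = 1 := by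
  ext t
  rw [mul_sub, mul_one, map_sub, PowerSeries.coeff_mul_X_pow', PowerSeries.coeff_mk,
    PowerSeries.coeff_mk, PowerSeries.coeff_one]
  rcases le_or_gt b t with h | h
  · rw [if_pos h, if_neg (by omega : t ≠ 0), if_congr (dvd_sub_self_iff h) rfl rfl]
    simp
  · rw [if_neg h.not_ge, sub_zero]
    refine if_congr ⟨fun hd => Nat.eq_zero_of_dvd_of_lt hd h, ?_⟩ rfl rfl
    rintro rfl
    exact dvd_zero b

theorem mk_restrictedPartition {n : ℕ} {a : Fin n → ℕ} (ha : ∀ i, 0 < a i) :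
    PowerSeries.mk (fun t => (restrictedPartition n a t : ℂ)) =
      ∏ i, PowerSeries.mk (fun t => if a i ∣ t then (1 : ℂ) else 0) := by
  classical
  ext t
  rw [PowerSeries.coeff_prod, PowerSeries.coeff_mk]
  simp only [PowerSeries.coeff_mk, Finset.prod_ite_zero, Finset.prod_const_one, Finset.mem_univ,
    true_imp_iff]
  rw [Finset.sum_boole, Nat.cast_inj, restrictedPartition]
  refine (Nat.card_congr ?_).trans (Nat.card_eq_finsetCard _)
  exact
    { toFun := fun m => ⟨Finsupp.equivFunOnFinite.symm fun i => m.1 i * a i, by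
        simpa using m.2⟩
      invFun := fun l => ⟨fun i => l.1 i / a i, by
        obtain ⟨l, hl⟩ := l
        simp only [Finset.mem_filter, Finset.mem_finsuppAntidiag] at hl
        exact (Finset.sum_congr rfl fun i _ => Nat.div_mul_cancel (hl.2 i)).trans hl.1.1⟩
      left_inv := fun m => by
        ext i
        simp [Nat.mul_div_cancel _ (ha i)]
      right_inv := fun l => by
        obtain ⟨l, hl⟩ := l
        simp only [Finset.mem_filter] at hl
        ext i
        simp [Nat.div_mul_cancel (hl.2 i)] }

theorem isExpSubst_restrictedPartition {n : ℕ} {a : Fin n → ℕ} (ha : ∀ i, 0 < a i) :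
    IsExpSubst (PowerSeries.mk fun t => (restrictedPartition n a t : ℂ))
      ((∏ i, (1 - PowerSeries.rescale ((a i : ℂ)) (PowerSeries.exp ℂ)) :
        PowerSeries ℂ) : LaurentSeries ℂ)⁻¹ := by
  have hD : (∏ i, (1 - Polynomial.X ^ a i) : Polynomial ℂ) ≠ 0 := by
    refine Finset.prod_ne_zero_iff.2 fun i _ h => ?_
    simpa [(ha i).ne'] using congrArg (Polynomial.eval 0) h
  have haeval : Polynomial.aeval (PowerSeries.exp ℂ)
      (∏ i, (1 - Polynomial.X ^ a i) : Polynomial ℂ) =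
      ∏ i, (1 - PowerSeries.rescale ((a i : ℂ)) (PowerSeries.exp ℂ)) := by
    simp [map_prod, PowerSeries.exp_pow_eq_rescale_exp]
  refine ⟨1, ∏ i, (1 - Polynomial.X ^ a i), hD, ?_, ?_⟩
  · have hcoe : ((∏ i, (1 - Polynomial.X ^ a i) : Polynomial ℂ) : PowerSeries ℂ) =
        ∏ i, (1 - PowerSeries.X ^ a i) := by
      rw [← Polynomial.coeToPowerSeries.ringHom_apply, map_prod]
      simp
    rw [hcoe, mk_restrictedPartition ha, ← Finset.prod_mul_distrib, Polynomial.coe_one]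
    exact Finset.prod_eq_one fun i _ => mk_dvd_mul_one_sub_X_pow (ha i)
  · rw [← haeval, coe_aeval_exp, map_one]
    exact inv_mul_cancel₀ (aeval_laurentExp_ne_zero hD)

theorem finite_setOf_exists_pow_eq_one {n : ℕ} {a : Fin n → ℕ} (ha : ∀ i, 0 < a i) :
    {μ : ℂ | ∃ i, μ ^ a i = 1}.Finite := by
  rw [Set.ofPred_exists]
  refine Set.finite_iUnion fun i => ?_
  refine (Polynomial.nthRoots (a i) (1 : ℂ)).toFinset.finite_toSet.subset fun μ hμ => ?_
  simpa [Polynomial.mem_nthRoots (ha i)] using hμ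

/-- The polynomial part `P_A(t)` (the polynomial attached to `λ = 1` in the root-of-unity
decomposition `p_A(t) = ∑_λ P_{A,λ}(t) λ^t`) equals the negative of the residue at `z = 0`
(the coefficient of `z^{-1}` in the formal Laurent expansion) of
`e^{-tz} / ((1 - e^{a_1 z}) ⋯ (1 - e^{a_n z}))`; equivalently, it is the constant term of
`- z e^{-tz} / ((1 - e^{a_1 z}) ⋯ (1 - e^{a_n z}))`. -/
theorem polynomialPart_eq_neg_residue (n : ℕ) (a : Fin n → ℕ) (ha : ∀ i, 0 < a i)
    (P : ℂ → Polynomial ℂ)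
    (hsupp : ∀ μ : ℂ, P μ ≠ 0 → ∃ i, μ ^ (a i) = 1)
    (hdecomp : ∀ t : ℕ, (restrictedPartition n a t : ℂ) =
      ∑ᶠ μ : ℂ, (P μ).eval (t : ℂ) * μ ^ t)
    (t : ℕ) :
    (P 1).eval (t : ℂ) =
      -(((PowerSeries.rescale (-(t : ℂ)) (PowerSeries.exp ℂ) : PowerSeries ℂ) : LaurentSeries ℂ) *
          ((∏ i, (1 - PowerSeries.rescale ((a i : ℂ)) (PowerSeries.exp ℂ)) :
            PowerSeries ℂ) : LaurentSeries ℂ)⁻¹).coeff (-1) ∧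
    (P 1).eval (t : ℂ) =
      (-(((PowerSeries.X : PowerSeries ℂ) : LaurentSeries ℂ) *
          ((PowerSeries.rescale (-(t : ℂ)) (PowerSeries.exp ℂ) : PowerSeries ℂ) : LaurentSeries ℂ) *
          ((∏ i, (1 - PowerSeries.rescale ((a i : ℂ)) (PowerSeries.exp ℂ)) :
            PowerSeries ℂ) : LaurentSeries ℂ)⁻¹)).coeff 0 := by
  have hF := isExpSubst_restrictedPartition ha
  set S : Finset ℂ := insert 1 (finite_setOf_exists_pow_eq_one ha).toFinset with hS
  choose g hg hres using fun μ => exists_isExpSubst_polynomial_mul_pow μ (P μ)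
  have hsum : PowerSeries.mk (fun t => (restrictedPartition n a t : ℂ)) =
      ∑ μ ∈ S, PowerSeries.mk fun t => (P μ).eval (t : ℂ) * μ ^ t := by
    ext s
    rw [map_sum, PowerSeries.coeff_mk, hdecomp s]
    simp only [PowerSeries.coeff_mk]
    refine finsum_eq_sum_of_support_subset _ fun μ hμ => ?_
    have hP : P μ ≠ 0 := by
      rintro h
      simp [h] at hμ
    simpa [hS] using Or.inr (hsupp μ hP)
  rw [hsum] at hF
  have hmain : (P 1).eval (t : ℂ) = -twistedResidue t
      ((∏ i, (1 - PowerSeries.rescale ((a i : ℂ)) (PowerSeries.exp ℂ)) :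
        PowerSeries ℂ) : LaurentSeries ℂ)⁻¹ := by
    rw [hF.unique (IsExpSubst.sum S fun μ _ => hg μ), map_sum,
      Finset.sum_eq_single_of_mem 1 (Finset.mem_insert_self _ _), hres, if_pos rfl, neg_neg]
    intro μ _ hμ
    rw [hres, if_neg hμ]
  rw [twistedResidue_apply] at hmain
  refine ⟨?_, hmain⟩
  rw [hmain, mul_assoc, laurentX, HahnSeries.ofPowerSeries_X, HahnSeries.coeff_single_mul, one_mul]
  rfl
end

section
/- The polynomial part satisfies P_A(t) = (1/(a_1⋯a_n)) Σ_{m=0}^{n-1} [(-1)^m/(n-1-m)!] Σ_{k_1 + 2k_2 + ⋯ + m k_m = m} [(-1)^{k_2+⋯+k_m}/(k_1!⋯k_m!)] * (B_1 s_1/(1·1!))^{k_1} ⋯ (B_m s_m/(m·m!))^{k_m} * t^{n-1-m}, where s_i = a_1^i + ⋯ + a_n^i and B_j are Bernoulli numbers. -/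
namespace PolynomialPart

open PowerSeries

/-- The substitution `x ↦ e^{-z}` from polynomials to formal power series. -/
noncomputable def substExpNeg : Polynomial ℂ →ₐ[ℂ] ℂ⟦X⟧ :=
  Polynomial.aeval (rescale (-1) (exp ℂ))

lemma derivative_rescale_exp (c : ℂ) :
    d⁄dX ℂ (rescale c (exp ℂ)) = C c * rescale c (exp ℂ) := by
  ext n
  rw [coeff_derivative, coeff_C_mul, coeff_rescale, coeff_rescale, coeff_exp, coeff_exp,
    Nat.factorial_succ]
  have h : (n.factorial : ℂ) ≠ 0 := by exact_mod_cast n.factorial_ne_zero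
  have h' : (n : ℂ) + 1 ≠ 0 := by exact_mod_cast n.succ_ne_zero
  simp only [one_div, map_inv₀, map_natCast]
  push_cast
  field_simp
  ring

lemma derivative_substExpNeg (N : Polynomial ℂ) :
    d⁄dX ℂ (substExpNeg N) = -substExpNeg (Polynomial.X * Polynomial.derivative N) := by
  rw [substExpNeg, Derivation.map_aeval, derivative_rescale_exp]
  simp
  ring

lemma constantCoeff_substExpNeg (N : Polynomial ℂ) :
    constantCoeff (substExpNeg N) = N.eval 1 := by
  rw [substExpNeg, ← Polynomial.coe_aeval_eq_eval]
  have h : ((constantCoeff (R := ℂ)).comp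
      (Polynomial.aeval (rescale (-1) (exp ℂ)) : Polynomial ℂ →ₐ[ℂ] ℂ⟦X⟧).toRingHom) =
      (Polynomial.aeval (1 : ℂ)).toRingHom := by
    ext
    · simp
    · simp [← coeff_zero_eq_constantCoeff_apply, coeff_rescale]
  exact congrArg (fun g => g N) h

/-- The power series `f` is a rational function, and `f (e^{-z}) = h (z) / z ^ k`. -/
def HasExpansion (f : ℂ⟦X⟧) (k : ℕ) (h : ℂ⟦X⟧) : Prop :=
  ∃ N D : Polynomial ℂ, substExpNeg D ≠ 0 ∧ (D : ℂ⟦X⟧) * f = N ∧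
    substExpNeg N * X ^ k = substExpNeg D * h

namespace HasExpansion

variable {f g h h' : ℂ⟦X⟧} {k l : ℕ}

lemma zero : HasExpansion 0 k 0 := ⟨0, 1, by simp, by simp, by simp⟩

lemma add (hf : HasExpansion f k h) (hg : HasExpansion g k h') :
    HasExpansion (f + g) k (h + h') := by
  obtain ⟨N, D, hD, h1, h2⟩ := hf
  obtain ⟨N', D', hD', h1', h2'⟩ := hg
  refine ⟨N * D' + N' * D, D * D', ?_, ?_, ?_⟩
  · rw [map_mul]
    exact mul_ne_zero hD hD'
  · push_cast
    linear_combination (D' : ℂ⟦X⟧) * h1 + (D : ℂ⟦X⟧) * h1'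
  · simp only [map_mul, map_add]
    linear_combination substExpNeg D' * h2 + substExpNeg D * h2'

lemma const_mul (hf : HasExpansion f k h) (c : ℂ) : HasExpansion (C c * f) k (C c * h) := by
  obtain ⟨N, D, hD, h1, h2⟩ := hf
  refine ⟨Polynomial.C c * N, D, hD, ?_, ?_⟩
  · push_cast
    linear_combination C c * h1
  · rw [map_mul, substExpNeg, Polynomial.aeval_C, ← substExpNeg]
    change C c * _ * _ = _
    linear_combination C c * h2

lemma sum {ι : Type*} {s : Finset ι} {F H : ι → ℂ⟦X⟧}
    (hF : ∀ i ∈ s, HasExpansion (F i) k (H i)) :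
    HasExpansion (∑ i ∈ s, F i) k (∑ i ∈ s, H i) := by
  classical
  induction s using Finset.induction_on with
  | empty => simpa using zero
  | insert i s hi ih =>
    rw [Finset.sum_insert hi, Finset.sum_insert hi]
    exact (hF i (by simp)).add (ih fun j hj => hF j (by simp [hj]))

lemma shift_iff : HasExpansion f (k + l) (X ^ l * h) ↔ HasExpansion f k h := by
  refine exists_congr fun N => exists_congr fun D => and_congr_right fun _ =>
    and_congr_right fun _ => ⟨fun e => ?_, fun e => ?_⟩
  · refine mul_right_cancel₀ (pow_ne_zero l (X_ne_zero (R := ℂ))) ?_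
    linear_combination e
  · linear_combination X ^ l * e

lemma unique (hf : HasExpansion f k h) (hf' : HasExpansion f l h') :
    X ^ l * h = X ^ k * h' := by
  obtain ⟨N, D, hD, h1, h2⟩ := hf
  obtain ⟨N', D', hD', h1', h2'⟩ := hf'
  have e : D' * N = D * N' := by
    rw [← Polynomial.coe_inj]
    push_cast
    linear_combination (D : ℂ⟦X⟧) * h1' - (D' : ℂ⟦X⟧) * h1
  have e' := congrArg substExpNeg e
  rw [map_mul, map_mul] at e'
  refine mul_left_cancel₀ (mul_ne_zero hD hD') ?_
  linear_combination X ^ (k + l) * e' - substExpNeg D' * X ^ l * h2 + substExpNeg D * X ^ k * h2'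

/-- The operator `x d/dx` becomes `-d/dz` under `x = e^{-z}`. -/
lemma euler (hf : HasExpansion f k h) :
    HasExpansion (X * d⁄dX ℂ f) (k + 1) ((k : ℂ⟦X⟧) * h - X * d⁄dX ℂ h) := by
  obtain ⟨N, D, hD, h1, h2⟩ := hf
  have h3 := congrArg (d⁄dX ℂ) h1
  have h4 := congrArg (fun u => X * d⁄dX ℂ u) h2
  simp only [Derivation.leibniz, derivative_coe, smul_eq_mul, derivative_pow, derivative_X,
    derivative_substExpNeg, map_mul] at h3 h4
  have hX : (X : ℂ⟦X⟧) * ((k : ℂ⟦X⟧) * X ^ (k - 1)) = (k : ℂ⟦X⟧) * X ^ k := by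
    cases k <;> simp
    ring
  refine ⟨Polynomial.X * (D * Polynomial.derivative N - N * Polynomial.derivative D), D ^ 2,
    ?_, ?_, ?_⟩
  · rw [map_pow]
    exact pow_ne_zero 2 hD
  · push_cast
    linear_combination X * (D : ℂ⟦X⟧) * h3 - X * (Polynomial.derivative D : ℂ⟦X⟧) * h1
  · simp only [map_mul, map_sub, map_pow]
    linear_combination (-substExpNeg D) * h4 + (substExpNeg D * (k : ℂ⟦X⟧) -
      X * substExpNeg Polynomial.X * substExpNeg (Polynomial.derivative D)) * h2 + substExpNeg D * substExpNeg N * hX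

end HasExpansion

lemma X_mul_derivative_mk (u : ℕ → ℂ) :
    X * d⁄dX ℂ (mk u) = mk fun t => (t : ℂ) * u t := by
  ext t
  cases t with
  | zero => simp
  | succ t => rw [coeff_succ_X_mul, coeff_derivative]; simp; ring

/-- The exponential polynomials with base `μ ≠ 1` contribute no pole at `z = 0`. -/
lemma exists_hasExpansion_of_ne_one {μ : ℂ} (hμ : μ ≠ 1) (Q : Polynomial ℂ) :
    ∃ h, HasExpansion (mk fun t => Q.eval (t : ℂ) * μ ^ t) 0 h := by
  induction Q using Polynomial.induction_on with
  | C c =>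
    have hD : constantCoeff (substExpNeg (1 - Polynomial.C μ * Polynomial.X)) ≠ 0 := by
      rw [constantCoeff_substExpNeg]
      simpa [sub_eq_zero] using hμ.symm
    refine ⟨C c * (substExpNeg (1 - Polynomial.C μ * Polynomial.X))⁻¹, ?_⟩
    have e : (mk fun t => (Polynomial.C c).eval (t : ℂ) * μ ^ t) = C c * mk fun t => μ ^ t := by
      ext; simp
    rw [e]
    refine HasExpansion.const_mul ⟨1, 1 - Polynomial.C μ * Polynomial.X, ?_, ?_, ?_⟩ c
    · intro h0
      simp [h0] at hD
    · push_cast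
      ext t
      cases t with
      | zero => simp [sub_mul]
      | succ t => simp [sub_mul, mul_assoc, coeff_succ_X_mul, coeff_one, pow_succ']
    · rw [PowerSeries.mul_inv_cancel _ hD, map_one, pow_zero, one_mul]
  | add P Q hP hQ =>
    obtain ⟨h, hP⟩ := hP
    obtain ⟨h', hQ⟩ := hQ
    refine ⟨h + h', ?_⟩
    convert hP.add hQ using 1
    ext; simp [add_mul]
  | monomial n c ih =>
    obtain ⟨h, ih⟩ := ih
    refine ⟨-d⁄dX ℂ h, HasExpansion.shift_iff (l := 1).1 ?_⟩
    convert ih.euler using 1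
    · rw [X_mul_derivative_mk]
      congr! 2 with t
      simp; ring
    · simp

/-- The Todd series `a z / (1 - e^{-a z})`. -/
noncomputable def todd (a : ℂ) : ℂ⟦X⟧ := rescale (-a) (bernoulliPowerSeries ℂ)

lemma one_sub_exp_mul_todd (a : ℂ) : (1 - rescale (-a) (exp ℂ)) * todd a = C a * X := by
  have h := congrArg (rescale (-a)) (bernoulliPowerSeries_mul_exp_sub_one ℂ)
  rw [map_mul, map_sub, map_one, rescale_X, ← todd, map_neg] at h
  linear_combination -h

lemma constantCoeff_todd (a : ℂ) : constantCoeff (todd a) = 1 := by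
  simp [todd, bernoulliPowerSeries, ← coeff_zero_eq_constantCoeff_apply, coeff_rescale]

lemma exists_hasExpansion_pow (k : ℕ) :
    ∃ g, HasExpansion (mk fun t => (t : ℂ) ^ k) (k + 1) (C (k.factorial : ℂ) + X ^ (k + 1) * g) := by
  induction k with
  | zero =>
    obtain ⟨g, hg⟩ : X ∣ todd 1 - 1 := by
      rw [X_dvd_iff, map_sub, constantCoeff_todd]; simp
    refine ⟨g, 1, 1 - Polynomial.X, ?_, ?_, ?_⟩
    · intro h0
      have h := one_sub_exp_mul_todd 1
      rw [map_sub, map_one, substExpNeg, Polynomial.aeval_X] at h0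
      rw [h0] at h
      rw [zero_mul, map_one, one_mul] at h
      exact X_ne_zero h.symm
    · push_cast
      ext t
      cases t with
      | zero => simp [sub_mul]
      | succ t => simp [sub_mul, coeff_succ_X_mul, coeff_one]
    · have h := one_sub_exp_mul_todd 1
      rw [map_sub, map_one, substExpNeg, Polynomial.aeval_X]
      simp only [map_one, one_mul] at h
      simp only [Nat.factorial_zero, Nat.cast_one, map_one, zero_add, pow_one, one_mul]
      rw [← hg, ← h]
      ring
  | succ k ih =>
    obtain ⟨g, ih⟩ := ih
    refine ⟨-d⁄dX ℂ g, ?_⟩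
    convert ih.euler using 1
    · rw [X_mul_derivative_mk]
      congr! 2 with t
      ring
    · rw [map_add, derivative_C, Derivation.leibniz, derivative_pow, derivative_X,
        Nat.factorial_succ]
      simp
      ring

/-- The expansion at `z = 0` of the generating function of a polynomial. -/
lemma exists_hasExpansion_polynomial (Q : Polynomial ℂ) {K : ℕ} (hK : Q.natDegree < K) :
    ∃ g, HasExpansion (mk fun t => Q.eval (t : ℂ)) K
      (∑ k ∈ Finset.range K, C (Q.coeff k * k.factorial) * X ^ (K - 1 - k) + X ^ K * g) := by
  choose g hg using exists_hasExpansion_pow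
  refine ⟨∑ k ∈ Finset.range K, C (Q.coeff k) * g k, ?_⟩
  convert HasExpansion.sum (s := Finset.range K)
    (F := fun k => C (Q.coeff k) * mk fun t : ℕ => (t : ℂ) ^ k)
    (H := fun k => C (Q.coeff k) * (X ^ (K - 1 - k) * (C (k.factorial : ℂ) + X ^ (k + 1) * g k)))
    (k := K) ?_ using 1
  · ext t
    simp [Polynomial.eval_eq_sum_range' hK]
  · rw [Finset.mul_sum, ← Finset.sum_add_distrib]
    refine Finset.sum_congr rfl fun k hk => ?_
    have e : K = (K - 1 - k) + (k + 1) := by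
      have := Finset.mem_range.1 hk
      omega
    have e' : (X : ℂ⟦X⟧) ^ K = X ^ (K - 1 - k) * X ^ (k + 1) := by rw [← pow_add, ← e]
    rw [e', map_mul]
    ring
  · intro k hk
    have e : k + 1 + (K - 1 - k) = K := by
      have := Finset.mem_range.1 hk
      omega
    have h := HasExpansion.shift_iff (l := K - 1 - k).2 (hg k)
    rw [e] at h
    exact h.const_mul _

lemma coeff_prod_mk_dvd {ι : Type*} [Fintype ι] [DecidableEq ι] (a : ι → ℕ) (ha : ∀ i, 0 < a i)
    (u : ι → ℕ → ℂ) (d : ℕ) :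
    coeff d (∏ i, mk fun t => if a i ∣ t then u i (t / a i) else 0) =
      ∑ k ∈ (Fintype.piFinset fun _ : ι => Finset.range (d + 1)).filter
        (fun k => ∑ i, a i * k i = d), ∏ i, u i (k i) := by
  rw [PowerSeries.coeff_prod]
  symm
  refine Finset.sum_bij_ne_zero (fun k _ _ => Finsupp.equivFunOnFinite.symm fun i => a i * k i)
    ?_ ?_ ?_ ?_
  · intro k hk _
    rw [Finset.mem_finsuppAntidiag]
    exact ⟨by simpa using (Finset.mem_filter.1 hk).2, Finset.subset_univ _⟩
  · intro k _ _ k' _ _ e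
    ext i
    have := DFunLike.congr_fun e i
    exact Nat.eq_of_mul_eq_mul_left (ha i) (by simpa using this)
  · intro l hl hne
    have hdvd : ∀ i, a i ∣ l i := by
      intro i
      by_contra hi
      exact hne (Finset.prod_eq_zero (Finset.mem_univ i) (by simp [hi]))
    have hsum : ∑ i, a i * (l i / a i) = d := by
      rw [← (Finset.mem_finsuppAntidiag.1 hl).1]
      exact Finset.sum_congr rfl fun i _ => Nat.mul_div_cancel' (hdvd i)
    refine ⟨fun i => l i / a i, ?_, ?_, ?_⟩
    · simp only [Finset.mem_filter, Fintype.mem_piFinset, Finset.mem_range, hsum, and_true]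
      intro i
      have h1 : a i * (l i / a i) ≤ d :=
        hsum ▸ Finset.single_le_sum (f := fun i => a i * (l i / a i)) (by simp) (Finset.mem_univ i)
      have h2 := Nat.le_mul_of_pos_left (l i / a i) (ha i)
      omega
    · simpa [hdvd] using hne
    · ext i
      simp [Nat.mul_div_cancel' (hdvd i)]
  · intro k _ _
    refine Finset.prod_congr rfl fun i _ => ?_
    simp [Nat.mul_div_cancel_left _ (ha i)]

lemma one_sub_X_pow_mul_mk {a : ℕ} (ha : 0 < a) :
    (1 - X ^ a) * (mk fun t => if a ∣ t then 1 else 0 : ℂ⟦X⟧) = 1 := by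
  ext t
  rw [sub_mul, one_mul, map_sub, coeff_X_pow_mul', coeff_mk, coeff_one]
  by_cases h : a ≤ t
  · have h0 : t ≠ 0 := by omega
    have e : a ∣ t - a ↔ a ∣ t := by
      rw [Nat.dvd_sub_self_right]
      exact ⟨fun h' => h'.elim id fun h'' => (le_antisymm h h'') ▸ dvd_rfl, Or.inl⟩
    simp [h, h0, e]
  · rcases Nat.eq_zero_or_pos t with rfl | ht
    · simp [h]
    · simp [h, ht.ne', Nat.not_dvd_of_pos_of_lt ht (Nat.lt_of_not_le h)]

lemma restrictedPartition_eq_card (n : ℕ) (a : Fin n → ℕ) (ha : ∀ i, 0 < a i) (t : ℕ) :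
    restrictedPartition n a t = ((Fintype.piFinset fun _ : Fin n => Finset.range (t + 1)).filter
        (fun k => ∑ i, a i * k i = t)).card := by
  rw [restrictedPartition]
  refine Nat.subtype_card _ fun k => ?_
  simp only [Finset.mem_filter, Fintype.mem_piFinset, Finset.mem_range, mul_comm (a _)]
  refine and_iff_right_of_imp fun hk i => ?_
  have h1 : k i * a i ≤ t :=
    hk ▸ Finset.single_le_sum (f := fun i => k i * a i) (by simp) (Finset.mem_univ i)
  have h2 := Nat.le_mul_of_pos_right (k i) (ha i)
  omega

lemma mk_restrictedPartition (n : ℕ) (a : Fin n → ℕ) (ha : ∀ i, 0 < a i) :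
    (mk fun t => (restrictedPartition n a t : ℂ)) =
      ∏ i, mk fun t => if a i ∣ t then 1 else 0 := by
  ext t
  rw [coeff_mk, restrictedPartition_eq_card n a ha, coeff_prod_mk_dvd a ha (fun _ _ => 1)]
  simp

lemma hasExpansion_restrictedPartition (n : ℕ) (a : Fin n → ℕ) (ha : ∀ i, 0 < a i) :
    HasExpansion (mk fun t => (restrictedPartition n a t : ℂ)) n
      (C (∏ i, (a i : ℂ))⁻¹ * ∏ i, todd (a i)) := by
  have ha' : ∏ i, (a i : ℂ) ≠ 0 :=
    Finset.prod_ne_zero_iff.2 fun i _ => by exact_mod_cast (ha i).ne'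
  have e : substExpNeg (∏ i, (1 - Polynomial.X ^ a i)) * ∏ i, todd (a i) =
      C (∏ i, (a i : ℂ)) * X ^ n := by
    rw [map_prod, ← Finset.prod_mul_distrib]
    have : ∀ i, substExpNeg (1 - Polynomial.X ^ a i) * todd (a i) = C (a i : ℂ) * X := by
      intro i
      rw [← one_sub_exp_mul_todd, map_sub, map_one, map_pow, substExpNeg, Polynomial.aeval_X,
        ← map_pow, exp_pow_eq_rescale_exp, rescale_rescale]
      simp
    rw [Finset.prod_congr rfl fun i _ => this i, Finset.prod_mul_distrib, map_prod]
    simp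
  refine ⟨1, ∏ i, (1 - Polynomial.X ^ a i), ?_, ?_, ?_⟩
  · intro h0
    rw [h0, zero_mul] at e
    refine mul_ne_zero ?_ (pow_ne_zero n X_ne_zero) e.symm
    exact fun h => ha' (C_injective (h.trans (map_zero _).symm))
  · rw [mk_restrictedPartition n a ha, ← Polynomial.coeToPowerSeries.ringHom_apply, map_prod,
      ← Finset.prod_mul_distrib]
    simp only [Polynomial.coeToPowerSeries.ringHom_apply]
    push_cast
    exact Finset.prod_eq_one fun i _ => one_sub_X_pow_mul_mk (ha i)
  · have hc : C (∏ i, (a i : ℂ))⁻¹ * C (∏ i, (a i : ℂ)) = 1 := by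
      rw [← map_mul, inv_mul_cancel₀ ha', map_one]
    rw [map_one]
    linear_combination (-C (∏ i, (a i : ℂ))⁻¹) * e - X ^ n * hc

lemma X_mul_derivative_todd {a : ℂ} (ha : a ≠ 0) :
    X * d⁄dX ℂ (todd a) = todd a * (1 - rescale a (bernoulliPowerSeries ℂ)) := by
  set e := rescale (-a) (exp ℂ) with he
  have h1 : (1 - e) * todd a = C a * X := one_sub_exp_mul_todd a
  have hne : 1 - e ≠ 0 := by
    intro h0
    rw [h0, zero_mul] at h1
    exact mul_ne_zero (by simpa using ha) X_ne_zero h1.symm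
  have h2 := congrArg (rescale a) (bernoulliPowerSeries_mul_exp_sub_one ℂ)
  rw [map_mul, map_sub, map_one, rescale_X] at h2
  have h3 : rescale a (exp ℂ) * e = 1 := by
    have h := congrArg (rescale a) (exp_mul_exp_neg_eq_one (A := ℂ))
    rw [map_mul, map_one, evalNegHom, rescale_rescale] at h
    simpa [he] using h
  have h4 : rescale a (bernoulliPowerSeries ℂ) = e * todd a := by
    refine mul_left_cancel₀ hne ?_
    linear_combination e * h2 - rescale a (bernoulliPowerSeries ℂ) * h3 - e * h1
  have h5 := congrArg (d⁄dX ℂ) h1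
  have h6 : d⁄dX ℂ e = C (-a) * e := derivative_rescale_exp (-a)
  simp only [Derivation.leibniz, map_sub, h6, derivative_C, derivative_X, smul_eq_mul,
    derivative_one, map_neg] at h5
  rw [h4]
  refine mul_left_cancel₀ hne ?_
  linear_combination X * h5 - h1 + todd a * e * h1

lemma X_mul_derivative_prod {ι : Type*} (s : Finset ι) {F G : ι → ℂ⟦X⟧}
    (h : ∀ i ∈ s, X * d⁄dX ℂ (F i) = F i * G i) :
    X * d⁄dX ℂ (∏ i ∈ s, F i) = (∏ i ∈ s, F i) * ∑ i ∈ s, G i := by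
  classical
  induction s using Finset.induction_on with
  | empty => simp
  | insert i s hi ih =>
    rw [Finset.prod_insert hi, Finset.sum_insert hi, Derivation.leibniz, smul_eq_mul, smul_eq_mul]
    linear_combination F i * ih (fun j hj => h j (by simp [hj])) +
      (∏ j ∈ s, F j) * h i (by simp)

lemma coeff_eq_of_logDeriv_eq {F G F' G' : ℂ⟦X⟧} {m : ℕ} (hF : X * d⁄dX ℂ F = F * G)
    (hF' : X * d⁄dX ℂ F' = F' * G') (h0 : coeff 0 F = coeff 0 F') (hG : coeff 0 G = 0)
    (hGG' : ∀ l ≤ m, coeff l G = coeff l G') : ∀ l ≤ m, coeff l F = coeff l F' := by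
  intro l
  induction l using Nat.strong_induction_on with
  | _ l ih =>
    intro hl
    cases l with
    | zero => exact h0
    | succ l =>
      have h1 := congrArg (coeff (l + 1)) hF
      have h2 := congrArg (coeff (l + 1)) hF'
      rw [coeff_succ_X_mul, coeff_derivative, PowerSeries.coeff_mul] at h1 h2
      have hne : (l : ℂ) + 1 ≠ 0 := by exact_mod_cast l.succ_ne_zero
      refine mul_right_cancel₀ hne ?_
      rw [h1, h2]
      refine Finset.sum_congr rfl fun p hp => ?_
      have hp' : p.1 + p.2 = l + 1 := Finset.HasAntidiagonal.mem_antidiagonal.1 hp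
      rw [← hGG' p.2 (by omega)]
      by_cases hp2 : p.2 = 0
      · rw [hp2, hG, mul_zero, mul_zero]
      · rw [ih p.1 (by omega) (by omega)]

/-- The series `exp (c z ^ j)`. -/
noncomputable def expMonomial (c : ℂ) (j : ℕ) : ℂ⟦X⟧ :=
  mk fun t => if j ∣ t then c ^ (t / j) / (t / j).factorial else 0

lemma X_mul_derivative_expMonomial (c : ℂ) {j : ℕ} (hj : 0 < j) :
    X * d⁄dX ℂ (expMonomial c j) = expMonomial c j * (C (j * c) * X ^ j) := by
  have e : expMonomial c j * (C (j * c) * X ^ j) = C (j * c) * (X ^ j * expMonomial c j) := by ring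
  rw [e, expMonomial, X_mul_derivative_mk]
  ext t
  rw [coeff_C_mul, coeff_X_pow_mul', coeff_mk, coeff_mk]
  by_cases hd : j ∣ t
  · obtain ⟨q, rfl⟩ := hd
    cases q with
    | zero => simp [hj.ne']
    | succ q =>
      have e1 : j * (q + 1) - j = j * q := by rw [mul_add, mul_one, Nat.add_sub_cancel]
      have e2 : j ≤ j * (q + 1) := Nat.le_mul_of_pos_right j q.succ_pos
      have h : (q.factorial : ℂ) ≠ 0 := by exact_mod_cast q.factorial_ne_zero
      have h' : (q : ℂ) + 1 ≠ 0 := by exact_mod_cast q.succ_ne_zero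
      rw [if_pos (dvd_mul_right _ _), if_pos e2, e1, if_pos (dvd_mul_right _ _),
        Nat.mul_div_cancel_left _ hj, Nat.mul_div_cancel_left _ hj, Nat.factorial_succ]
      push_cast
      field_simp
      ring
  · by_cases hle : j ≤ t
    · have hd' : ¬ j ∣ t - j := fun h =>
        hd ((Nat.dvd_sub_self_right.1 h).resolve_right fun h' => hd (le_antisymm hle h' ▸ dvd_rfl))
      simp [hd, hd']
    · simp [hd, hle]

lemma coeff_prod_todd {ι : Type*} [Fintype ι] (a : ι → ℂ) (ha : ∀ i, a i ≠ 0) (m : ℕ) :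
    coeff m (∏ i, todd (a i)) =
      ∑ k ∈ (Fintype.piFinset fun _ : Fin m => Finset.range (m + 1)).filter
        (fun k => ∑ j : Fin m, ((j : ℕ) + 1) * k j = m),
        ∏ j : Fin m, (-((bernoulli ((j : ℕ) + 1) : ℂ) * (∑ i, a i ^ ((j : ℕ) + 1)) /
          (((j : ℕ) + 1) * (((j : ℕ) + 1).factorial)))) ^ k j / (k j).factorial := by
  set b : ℕ → ℂ := fun j => -((bernoulli (j + 1) : ℂ) * (∑ i, a i ^ (j + 1)) /
          ((j + 1) * ((j + 1).factorial))) with hb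
  rw [← coeff_prod_mk_dvd (fun j : Fin m => (j : ℕ) + 1) (fun j => Nat.succ_pos _)
    (fun j q => b j ^ q / q.factorial) m]
  change _ = coeff m (∏ j : Fin m, expMonomial (b j) (j + 1))
  have hG : coeff 0 (∑ i, (1 - rescale (a i) (bernoulliPowerSeries ℂ))) = 0 := by
    simp only [map_sum, map_sub, coeff_zero_one, coeff_rescale, bernoulliPowerSeries, coeff_mk]
    simp
  refine coeff_eq_of_logDeriv_eq
    (X_mul_derivative_prod Finset.univ fun i _ => X_mul_derivative_todd (ha i))
    (X_mul_derivative_prod Finset.univ fun (j : Fin m) _ =>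
      X_mul_derivative_expMonomial (b j) (Nat.succ_pos (j : ℕ)))
    ?_ ?_ (fun l hl => ?_) m le_rfl
  · simp only [coeff_zero_eq_constantCoeff_apply, map_prod, constantCoeff_todd]
    simp [← coeff_zero_eq_constantCoeff_apply, expMonomial]
  · exact hG
  · cases l with
    | zero =>
      rw [hG]
      simp only [map_sum, coeff_C_mul, coeff_X_pow]
      simp
    | succ l =>
      have hne : (l : ℂ) + 1 ≠ 0 := by exact_mod_cast l.succ_ne_zero
      have hne' : ((l + 1).factorial : ℂ) ≠ 0 := by exact_mod_cast (l + 1).factorial_ne_zero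
      simp only [map_sum, map_sub, coeff_one, coeff_rescale, bernoulliPowerSeries, coeff_mk,
        coeff_C_mul, coeff_X_pow]
      rw [Finset.sum_eq_single (⟨l, hl⟩ : Fin m)]
      · simp [hb, ← Finset.sum_mul]
        field_simp
      · intro j _ hj
        have : l ≠ j := fun h => hj (Fin.ext h.symm)
        simp [this]
      · simp

lemma powerSum_term_sign {m : ℕ} (x : ℕ → ℂ) (hx : ∀ j, Odd (j + 1) → 1 < j + 1 → x j = 0)
    {k : Fin m → ℕ} (hk : ∑ j : Fin m, ((j : ℕ) + 1) * k j = m) :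
    (-1) ^ m * ((-1) ^ (∑ j ∈ Finset.univ.filter (fun j : Fin m => 1 ≤ (j : ℕ)), k j) /
      (∏ j : Fin m, ((k j).factorial : ℂ)) * ∏ j : Fin m, x j ^ k j) =
    ∏ j : Fin m, (-x j) ^ k j / (k j).factorial := by
  have h1 : ((-1 : ℂ)) ^ m = ∏ j : Fin m, ((-1) ^ ((j : ℕ) + 1)) ^ k j := by
    conv_lhs => rw [← hk]
    simp only [← Finset.prod_pow_eq_pow_sum, pow_mul]
  rw [Finset.sum_filter, ← Finset.prod_pow_eq_pow_sum, h1, Finset.prod_div_distrib,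
    div_mul_eq_mul_div, ← mul_div_assoc, ← Finset.prod_mul_distrib, ← Finset.prod_mul_distrib]
  congr 1
  refine Finset.prod_congr rfl fun j _ => ?_
  rcases Nat.eq_zero_or_pos (j : ℕ) with h0 | hpos
  · simp [h0, ← mul_pow]
  · rw [if_pos (Nat.succ_le_of_lt hpos), ← mul_pow, ← mul_pow]
    congr 1
    rcases Nat.even_or_odd ((j : ℕ) + 1) with he | ho
    · rw [he.neg_one_pow]
      ring
    · rw [hx j ho (by omega)]
      simp

/-- The coefficients of the polynomial part are those of the expansion at `z = 0`. -/
lemma coeff_mul_factorial {n : ℕ} {a : Fin n → ℕ} (ha : ∀ i, 0 < a i) {P : ℂ → Polynomial ℂ}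
    (hsupp : ∀ μ : ℂ, P μ ≠ 0 → ∃ i, μ ^ (a i) = 1)
    (hdecomp : ∀ t : ℕ, (restrictedPartition n a t : ℂ) =
      ∑ᶠ μ : ℂ, (P μ).eval (t : ℂ) * μ ^ t) (k : ℕ) :
    (P 1).coeff k * k.factorial =
      if k < n then coeff (n - 1 - k) (C (∏ i, (a i : ℂ))⁻¹ * ∏ i, todd (a i)) else 0 := by
  classical
  set H := C (∏ i, (a i : ℂ))⁻¹ * ∏ i, todd (a i) with hH
  obtain ⟨S, hS⟩ : ∃ S : Finset ℂ, ∀ μ, P μ ≠ 0 → μ ∈ S := by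
    refine ⟨Finset.univ.biUnion fun i => (Polynomial.nthRoots (a i) (1 : ℂ)).toFinset,
      fun μ hμ => ?_⟩
    obtain ⟨i, hi⟩ := hsupp μ hμ
    simp only [Finset.mem_biUnion, Finset.mem_univ, true_and, Multiset.mem_toFinset]
    exact ⟨i, (Polynomial.mem_nthRoots (ha i)).2 hi⟩
  have hsum : (mk fun t => (restrictedPartition n a t : ℂ)) =
      (mk fun t => (P 1).eval (t : ℂ)) +
        ∑ μ ∈ S.erase 1, mk fun t => (P μ).eval (t : ℂ) * μ ^ t := by
    ext t
    rw [coeff_mk, hdecomp, finsum_eq_sum_of_support_subset (s := insert 1 (S.erase 1)) _,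
      Finset.sum_insert (by simp)]
    · simp
    · intro μ hμ
      by_cases h1 : μ = 1
      · simp [h1]
      · have : P μ ≠ 0 := by
          rintro h0
          simp [h0] at hμ
        simp [h1, hS μ this]
  choose! h hh using fun (μ : ℂ) (hμ : μ ≠ 1) => exists_hasExpansion_of_ne_one hμ (P μ)
  set K := n + k + (P 1).natDegree + 1 with hK
  obtain ⟨g, hg⟩ := exists_hasExpansion_polynomial (P 1) (K := K) (by omega)
  have hreg : HasExpansion (∑ μ ∈ S.erase 1, mk fun t => (P μ).eval (t : ℂ) * μ ^ t) (0 + K)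
      (X ^ K * ∑ μ ∈ S.erase 1, h μ) :=
    HasExpansion.shift_iff.2 (HasExpansion.sum fun μ hμ => hh μ (Finset.ne_of_mem_erase hμ))
  rw [zero_add] at hreg
  have key := (hasExpansion_restrictedPartition n a ha).unique (hsum ▸ hg.add hreg)
  have hc := congrArg (coeff (n + (K - 1 - k))) key
  rw [← hH, add_assoc, ← mul_add, add_comm n (K - 1 - k), coeff_X_pow_mul, map_add,
    coeff_X_pow_mul', coeff_X_pow_mul', if_neg (by omega : ¬ K ≤ K - 1 - k), add_zero, map_sum,
    Finset.sum_eq_single k, coeff_C_mul (n := K - 1 - k) (φ := X ^ (K - 1 - k)), coeff_X_pow,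
    if_pos rfl, mul_one] at hc
  · rw [← hc]
    by_cases hkn : k < n
    · rw [if_pos hkn, if_pos (by omega)]
      congr 2
      omega
    · rw [if_neg hkn, if_neg (by omega)]
  · intro j hj hjk
    rw [Finset.mem_range] at hj
    rw [coeff_C_mul, coeff_X_pow, if_neg (by omega), mul_zero]
  · intro hk
    exact absurd (Finset.mem_range.2 (by omega)) hk

end PolynomialPart

/-- Power-sum form of the polynomial part:
`P_A(t) = (1/(a_1⋯a_n)) ∑_{m=0}^{n-1} [(-1)^m/(n-1-m)!]
  ∑_{k_1+2k_2+⋯+mk_m=m} [(-1)^{k_2+⋯+k_m}/(k_1!⋯k_m!)]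
  (B_1 s_1/(1·1!))^{k_1} ⋯ (B_m s_m/(m·m!))^{k_m} t^{n-1-m}`,
where `s_i = a_1^i + ⋯ + a_n^i`.  In the inner sum, `k : Fin m → ℕ` encodes
`(k_1, ..., k_m)` via `k_j = k ⟨j-1⟩`. -/
theorem polynomialPart_powerSum_formula (n : ℕ) (hn : 0 < n) (a : Fin n → ℕ)
    (ha : ∀ i, 0 < a i)
    (P : ℂ → Polynomial ℂ)
    (hsupp : ∀ μ : ℂ, P μ ≠ 0 → ∃ i, μ ^ (a i) = 1)
    (hdecomp : ∀ t : ℕ, (restrictedPartition n a t : ℂ) =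
      ∑ᶠ μ : ℂ, (P μ).eval (t : ℂ) * μ ^ t)
    (t : ℕ) :
    (P 1).eval (t : ℂ) =
      (∏ i, (a i : ℂ))⁻¹ *
        ∑ m ∈ Finset.range n, (-1) ^ m / (n - 1 - m).factorial *
          (∑ k ∈ (Fintype.piFinset fun _ : Fin m => Finset.range (m + 1)).filter
              (fun k => ∑ j : Fin m, ((j : ℕ) + 1) * k j = m),
            ((-1) ^ (∑ j ∈ Finset.univ.filter (fun j : Fin m => 1 ≤ (j : ℕ)), k j) /
                ∏ j : Fin m, ((k j).factorial : ℂ)) *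
              ∏ j : Fin m,
                ((bernoulli ((j : ℕ) + 1) : ℂ) * (∑ i, (a i : ℂ) ^ ((j : ℕ) + 1)) /
                    (((j : ℕ) + 1) * (((j : ℕ) + 1).factorial))) ^ (k j)) *
          (t : ℂ) ^ (n - 1 - m) := by
  have hcoeff := PolynomialPart.coeff_mul_factorial ha hsupp hdecomp
  have hdeg : (P 1).natDegree < n := by
    refine Nat.lt_of_le_pred hn (Polynomial.natDegree_le_iff_coeff_eq_zero.2 fun k hk => ?_)
    rw [Nat.pred_eq_sub_one] at hk
    have h := hcoeff k
    rw [if_neg (by omega)] at h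
    exact (mul_eq_zero.1 h).resolve_right (by exact_mod_cast k.factorial_ne_zero)
  rw [Polynomial.eval_eq_sum_range' hdeg, ← Finset.sum_range_reflect, Finset.mul_sum]
  refine Finset.sum_congr rfl fun m hm => ?_
  rw [Finset.mem_range] at hm
  have h := hcoeff (n - 1 - m)
  rw [if_pos (by omega), show n - 1 - (n - 1 - m) = m by omega, PowerSeries.coeff_C_mul,
    PolynomialPart.coeff_prod_todd _ (fun i => by exact_mod_cast (ha i).ne')] at h
  rw [← eq_div_iff (by exact_mod_cast (n - 1 - m).factorial_ne_zero)] at h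
  rw [h]
  have hsign : ∀ k ∈ (Fintype.piFinset fun _ : Fin m => Finset.range (m + 1)).filter
      (fun k => ∑ j : Fin m, ((j : ℕ) + 1) * k j = m), _ := fun k hk =>
    PolynomialPart.powerSum_term_sign (fun j => (bernoulli (j + 1) : ℂ) *
      (∑ i, (a i : ℂ) ^ (j + 1)) / ((j + 1) * ((j + 1).factorial)))
      (fun j ho hj => by simp [bernoulli_eq_zero_of_odd ho hj]) (Finset.mem_filter.1 hk).2
  rw [← Finset.sum_congr rfl hsign, ← Finset.mul_sum]
  ring
end
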